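/- arXiv:2511.16116 — 7 statements merged into one kernel-verified Lean document; each statement's English description precedes it below -/
import Mathlib

section
/- Let β ∈ [0,2], λ > 0, γ ≥ 0 and α ∈ ℝ satisfy β + γ < 3 and α + γ > −1. Set p = (4 − β + α)/(3 − β − γ) and τ = (λ (3 − β − γ)^(4−β) / ((4 − β + α)^(3−β) (1 + α + γ)))^(1/(3−β−γ)). Then p > 1, τ > 0, and the function h(s) = τ s^p satisfies, for every s > 0, h'(s) > 0 and h''(s) · (h'(s))^(2−β) = λ s^α (h(s))^γ. -/
open Real

/-- **Radial ODE profile for the potential term.**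
For `β ∈ [0,2]`, `λ > 0`, `γ ≥ 0`, `α ∈ ℝ` with `β + γ < 3` and `α + γ > −1`, setting
`p = (4 − β + α)/(3 − β − γ)` and
`τ = (λ (3 − β − γ)^(4−β) / ((4 − β + α)^(3−β) (1 + α + γ)))^(1/(3−β−γ))`,
one has `p > 1`, `τ > 0`, and `h(s) = τ s^p` satisfies `h'(s) > 0` and
`h''(s) (h'(s))^(2−β) = λ s^α (h(s))^γ` for every `s > 0`. -/
theorem radial_ODE_potential_term
    (β lam γ α : ℝ) (hβ : β ∈ Set.Icc (0 : ℝ) 2) (hlam : 0 < lam)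
    (hγ : 0 ≤ γ) (hβγ : β + γ < 3) (hαγ : -1 < α + γ)
    (p τ : ℝ)
    (hp : p = (4 - β + α) / (3 - β - γ))
    (hτ : τ = (lam * (3 - β - γ) ^ (4 - β) /
        ((4 - β + α) ^ (3 - β) * (1 + α + γ))) ^ (1 / (3 - β - γ)))
    (h : ℝ → ℝ) (hh : ∀ s : ℝ, h s = τ * s ^ p) :
    1 < p ∧ 0 < τ ∧ ∀ s : ℝ, 0 < s →
      0 < deriv h s ∧
      deriv (deriv h) s * (deriv h s) ^ (2 - β) = lam * s ^ α * (h s) ^ γ := by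
  have hd : 0 < 3 - β - γ := by linarith
  have hc : 0 < 1 + α + γ := by linarith
  have ha : 0 < 4 - β + α := by linarith
  have hp1 : 1 < p := by
    rw [hp, one_lt_div hd]
    linarith
  have hp0 : 0 < p := by linarith
  have hpmul : p * (3 - β - γ) = 4 - β + α := by
    rw [hp, div_mul_cancel₀ _ hd.ne']
  have hbase : 0 < lam * (3 - β - γ) ^ (4 - β) /
      ((4 - β + α) ^ (3 - β) * (1 + α + γ)) := by positivity
  have hτ0 : 0 < τ := by
    rw [hτ]
    exact rpow_pos_of_pos hbase _
  have hτpow : τ ^ (3 - β - γ) * (p ^ (3 - β) * (p - 1)) = lam := by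
    have hp_sub : p - 1 = (1 + α + γ) / (3 - β - γ) := by
      rw [hp, div_sub_one hd.ne']
      ring
    have hd_pow : (3 - β - γ) ^ (4 - β) = (3 - β - γ) ^ (3 - β) * (3 - β - γ) := by
      rw [← rpow_add_one hd.ne']
      ring_nf
    rw [hτ, ← rpow_mul hbase.le, one_div_mul_cancel hd.ne', rpow_one, hp_sub, hp,
      div_rpow ha.le hd.le, hd_pow]
    have h₁ := (rpow_pos_of_pos hd (3 - β)).ne'
    have h₂ := (rpow_pos_of_pos ha (3 - β)).ne'
    generalize (3 - β - γ) ^ (3 - β) = x at *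
    generalize (4 - β + α) ^ (3 - β) = y at *
    have hd' := hd.ne'
    have hc' := hc.ne'
    field_simp
  obtain rfl : h = fun s => τ * s ^ p := funext hh
  have hderiv : deriv (fun s : ℝ => τ * s ^ p) = fun s => τ * (p * s ^ (p - 1)) := by
    ext s
    exact ((hasDerivAt_rpow_const (Or.inr hp1.le)).const_mul τ).deriv
  refine ⟨hp1, hτ0, fun s hs => ?_⟩
  have hderiv2 : deriv (fun s : ℝ => τ * (p * s ^ (p - 1))) s =
      τ * (p * ((p - 1) * s ^ (p - 1 - 1))) :=
    (((hasDerivAt_rpow_const (Or.inl hs.ne')).const_mul p).const_mul τ).deriv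
  rw [hderiv, hderiv2]
  refine ⟨by positivity, ?_⟩
  have hτ_split : τ * τ ^ (2 - β) = τ ^ (3 - β - γ) * τ ^ γ := by
    rw [← rpow_one_add' hτ0.le (by linarith [hβ.2]), ← rpow_add hτ0]
    ring_nf
  have hp_split : p * p ^ (2 - β) = p ^ (3 - β) := by
    rw [← rpow_one_add' hp0.le (by linarith [hβ.2])]
    ring_nf
  have hs_split : s ^ (p - 1 - 1) * s ^ ((p - 1) * (2 - β)) = s ^ α * s ^ (p * γ) := by
    rw [← rpow_add hs, ← rpow_add hs]
    congr 1
    linear_combination hpmul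
  rw [mul_rpow hτ0.le (by positivity), mul_rpow hp0.le (by positivity), ← rpow_mul hs.le,
    mul_rpow hτ0.le (by positivity), ← rpow_mul hs.le]
  calc _ = (τ * τ ^ (2 - β)) * (p * p ^ (2 - β)) * (p - 1) *
        (s ^ (p - 1 - 1) * s ^ ((p - 1) * (2 - β))) := by ring
    _ = (τ ^ (3 - β - γ) * (p ^ (3 - β) * (p - 1))) * τ ^ γ * (s ^ α * s ^ (p * γ)) := by
        rw [hτ_split, hp_split, hs_split]
        ring
    _ = _ := by
        rw [hτpow]
        ring
end

section
/- Let β ∈ [0,2], c > 0 and m > 0 satisfy m + β < 3. Set p₁ = (4 − m − β)/(3 − m − β) and τ₁ = (c (3 − m − β)^(4−m−β) / (4 − m − β)^(3−m−β))^(1/(3−m−β)). Then p₁ > 1, τ₁ > 0, and the function h(s) = τ₁ s^(p₁) satisfies, for every s > 0, h'(s) > 0 and h''(s) · (h'(s))^(2−β) = c (h'(s))^m. -/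
open Real

/-- **Radial ODE profile for the pure gradient Hamiltonian.**
For `β ∈ [0,2]`, `c > 0`, `m > 0` with `m + β < 3`, setting
`p₁ = (4 − m − β)/(3 − m − β)` and
`τ₁ = (c (3 − m − β)^(4−m−β) / (4 − m − β)^(3−m−β))^(1/(3−m−β))`,
one has `p₁ > 1`, `τ₁ > 0`, and `h(s) = τ₁ s^(p₁)` satisfies `h'(s) > 0` and
`h''(s) (h'(s))^(2−β) = c (h'(s))^m` for every `s > 0`. -/
theorem radial_ODE_gradient_term
    (β c m : ℝ) (hβ : β ∈ Set.Icc (0 : ℝ) 2) (hc : 0 < c) (hm : 0 < m)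
    (hmβ : m + β < 3)
    (p₁ τ₁ : ℝ)
    (hp : p₁ = (4 - m - β) / (3 - m - β))
    (hτ : τ₁ = (c * (3 - m - β) ^ (4 - m - β) /
        (4 - m - β) ^ (3 - m - β)) ^ (1 / (3 - m - β)))
    (h : ℝ → ℝ) (hh : ∀ s : ℝ, h s = τ₁ * s ^ p₁) :
    1 < p₁ ∧ 0 < τ₁ ∧ ∀ s : ℝ, 0 < s →
      0 < deriv h s ∧
      deriv (deriv h) s * (deriv h s) ^ (2 - β) = c * (deriv h s) ^ m := by
  obtain ⟨a, ha⟩ : ∃ a, a = 3 - m - β := ⟨_, rfl⟩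
  have ha0 : 0 < a := by linarith
  have ha1 : 4 - m - β = a + 1 := by linarith
  rw [ha1, ← ha] at hp hτ
  have hp1 : p₁ - 1 = 1 / a := by rw [hp]; field_simp; ring
  have hp_gt : 1 < p₁ := by
    have : 0 < 1 / a := by positivity
    linarith
  have hp0 : 0 < p₁ := by linarith
  have hτ0 : 0 < τ₁ := by rw [hτ]; positivity
  have hτa : τ₁ ^ a = c * a ^ (a + 1) / (a + 1) ^ a := by
    rw [hτ, ← rpow_mul (by positivity), one_div_mul_cancel ha0.ne', rpow_one]
  have hpow : (τ₁ * p₁) ^ a = c * a := by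
    rw [mul_rpow hτ0.le hp0.le, hτa, hp, div_rpow (by positivity) ha0.le,
      rpow_add_one ha0.ne']
    field_simp
  have hd : ∀ s : ℝ, 0 < s → deriv h s = τ₁ * p₁ * s ^ (1 / a) := by
    intro s hs
    rw [funext hh, ← hp1, mul_assoc]
    exact ((hasDerivAt_rpow_const (Or.inl hs.ne')).const_mul τ₁).deriv
  refine ⟨hp_gt, hτ0, fun s hs => ?_⟩
  have hpos : 0 < deriv h s := by rw [hd s hs]; positivity
  have hdd : deriv (deriv h) s = τ₁ * p₁ * (1 / a * s ^ (1 / a - 1)) := by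
    have heq : deriv h =ᶠ[nhds s] fun x => τ₁ * p₁ * x ^ (1 / a) := by
      filter_upwards [lt_mem_nhds hs] with x hx using hd x hx
    rw [heq.deriv_eq]
    exact ((hasDerivAt_rpow_const (Or.inl hs.ne')).const_mul (τ₁ * p₁)).deriv
  have hdd' : deriv (deriv h) s = deriv h s / (a * s) := by
    rw [hdd, hd s hs, rpow_sub_one hs.ne']
    field_simp
  have hda : (deriv h s) ^ a = c * a * s := by
    rw [hd s hs, mul_rpow (by positivity) (by positivity), hpow, ← rpow_mul hs.le,
      one_div_mul_cancel ha0.ne', rpow_one]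
  refine ⟨hpos, ?_⟩
  calc deriv (deriv h) s * (deriv h s) ^ (2 - β)
      = (deriv h s) ^ (2 - β + 1) / (a * s) := by
        rw [hdd', rpow_add_one hpos.ne']; ring
    _ = (deriv h s) ^ a * (deriv h s) ^ m / (a * s) := by
        rw [← rpow_add hpos, ha]; ring_nf
    _ = c * (deriv h s) ^ m := by
        rw [hda]; field_simp
end

section
/- Let β ∈ [0,2], c > 0, m > 0 and q > 0 satisfy m + q + β < 3. Set p₁ = (4 − β − m)/(3 − m − β − q) and let τ₁ > 0 be the unique positive real number with τ₁^(3−β−m−q) = c (3 − β − m − q)^(4−β−m) / ((4 − β − m)^(3−β−m) (1 + q)) (equivalently, τ₁^(3−β) p₁^(3−β) (p₁ − 1) = c τ₁^(q+m) p₁^m). Then p₁ > 1 and the function h(s) = τ₁ s^(p₁) satisfies, for every s > 0, h'(s) > 0 and h''(s) · (h'(s))^(2−β) = c (h(s))^q (h'(s))^m. -/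
open Real

/-- The profile `s ↦ τ s ^ p` solves the radial equation once the powers of `s` balance and the
coefficient `τ` satisfies the resulting algebraic relation. -/
lemma rpow_profile_equation {β c m q p τ s : ℝ} (hp : 0 < p) (hτ : 0 < τ) (hs : 0 < s)
    (hexp : p * (3 - β - m - q) = 4 - β - m)
    (hcoef : τ ^ (3 - β - m - q) * p ^ (3 - β - m) * (p - 1) = c) :
    τ * (p * ((p - 1) * s ^ (p - 1 - 1))) * (τ * (p * s ^ (p - 1))) ^ (2 - β) =
      c * (τ * s ^ p) ^ q * (τ * (p * s ^ (p - 1))) ^ m := by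
  have hbase : ∀ r : ℝ, (τ * (p * s ^ (p - 1))) ^ r = τ ^ r * (p ^ r * s ^ ((p - 1) * r)) := by
    intro r
    rw [mul_rpow hτ.le (by positivity), mul_rpow hp.le (by positivity), ← rpow_mul hs.le]
  have hτpow : τ * τ ^ (2 - β) = τ ^ (3 - β - m - q) * τ ^ q * τ ^ m := by
    nth_rw 1 [← rpow_one τ]
    simp only [← rpow_add hτ]
    congr 1; ring
  have hppow : p * p ^ (2 - β) = p ^ (3 - β - m) * p ^ m := by
    nth_rw 1 [← rpow_one p]
    simp only [← rpow_add hp]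
    congr 1; ring
  have hspow : s ^ (p - 1 - 1) * s ^ ((p - 1) * (2 - β)) = s ^ (p * q) * s ^ ((p - 1) * m) := by
    rw [← rpow_add hs, ← rpow_add hs]
    congr 1; linear_combination hexp
  rw [hbase, hbase, mul_rpow hτ.le (by positivity), ← rpow_mul hs.le, ← hcoef]
  calc
    _ = (τ * τ ^ (2 - β)) * (p * p ^ (2 - β)) * (p - 1) *
        (s ^ (p - 1 - 1) * s ^ ((p - 1) * (2 - β))) := by ring
    _ = _ := by rw [hτpow, hppow, hspow]; ring

lemma deriv_const_mul_rpow (a r : ℝ) {s : ℝ} (hs : 0 < s) :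
    deriv (fun x : ℝ => a * x ^ r) s = a * (r * s ^ (r - 1)) :=
  ((hasDerivAt_rpow_const (Or.inl hs.ne')).const_mul a).deriv

/-- **Radial ODE profile for the Hamiltonian `u^q |∇u|^m`.**
For `β ∈ [0,2]`, `c > 0`, `m > 0`, `q > 0` with `m + q + β < 3`, setting
`p₁ = (4 − β − m)/(3 − m − β − q)` and letting `τ₁ > 0` be the unique positive real with
`τ₁^(3−β−m−q) = c (3 − β − m − q)^(4−β−m) / ((4 − β − m)^(3−β−m) (1 + q))`,
one has `p₁ > 1` and `h(s) = τ₁ s^(p₁)` satisfies `h'(s) > 0` and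
`h''(s) (h'(s))^(2−β) = c (h(s))^q (h'(s))^m` for every `s > 0`. -/
theorem radial_ODE_mixed_term
    (β c m q : ℝ) (hβ : β ∈ Set.Icc (0 : ℝ) 2) (hc : 0 < c) (hm : 0 < m) (hq : 0 < q)
    (hmqβ : m + q + β < 3)
    (p₁ τ₁ : ℝ)
    (hp : p₁ = (4 - β - m) / (3 - m - β - q))
    (hτpos : 0 < τ₁)
    (hτ : τ₁ ^ (3 - β - m - q) =
      c * (3 - β - m - q) ^ (4 - β - m) / ((4 - β - m) ^ (3 - β - m) * (1 + q)))
    (h : ℝ → ℝ) (hh : ∀ s : ℝ, h s = τ₁ * s ^ p₁) :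
    1 < p₁ ∧ ∀ s : ℝ, 0 < s →
      0 < deriv h s ∧
      deriv (deriv h) s * (deriv h s) ^ (2 - β) = c * (h s) ^ q * (deriv h s) ^ m := by
  have hd : 0 < 3 - β - m - q := by linarith
  have hA : 0 < 4 - β - m := by linarith
  have hd_eq : 3 - m - β - q = 3 - β - m - q := by ring
  rw [hd_eq] at hp
  have hp_one : 1 < p₁ := by
    rw [hp, one_lt_div hd]; linarith
  have hp_pos : 0 < p₁ := by linarith
  have hexp : p₁ * (3 - β - m - q) = 4 - β - m := by
    rw [hp, div_mul_cancel₀ _ hd.ne']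
  have hp_sub : p₁ - 1 = (1 + q) / (3 - β - m - q) := by
    rw [hp]; field_simp; ring
  have hcoef : τ₁ ^ (3 - β - m - q) * p₁ ^ (3 - β - m) * (p₁ - 1) = c := by
    have hpow : (3 - β - m - q) ^ (4 - β - m) =
        (3 - β - m - q) ^ (3 - β - m) * (3 - β - m - q) := by
      rw [← rpow_add_one hd.ne']; congr 1; ring
    have hApos := rpow_pos_of_pos hA (3 - β - m)
    have hdpos := rpow_pos_of_pos hd (3 - β - m)
    have hq_pos : 0 < 1 + q := by linarith
    rw [hτ, hp_sub, hp, div_rpow hA.le hd.le, hpow]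
    generalize (4 - β - m) ^ (3 - β - m) = a at *
    generalize (3 - β - m - q) ^ (3 - β - m) = b at *
    generalize 3 - β - m - q = d at *
    field_simp
  have hderiv : ∀ s : ℝ, 0 < s → deriv h s = τ₁ * (p₁ * s ^ (p₁ - 1)) := by
    intro s hs
    rw [funext hh]
    exact deriv_const_mul_rpow τ₁ p₁ hs
  have hderiv₂ : ∀ s : ℝ, 0 < s →
      deriv (deriv h) s = τ₁ * (p₁ * ((p₁ - 1) * s ^ (p₁ - 1 - 1))) := by
    intro s hs
    have heq : deriv h =ᶠ[nhds s] fun x => τ₁ * p₁ * x ^ (p₁ - 1) := by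
      filter_upwards [lt_mem_nhds hs] with x hx
      rw [hderiv x hx, mul_assoc]
    rw [heq.deriv_eq, deriv_const_mul_rpow _ _ hs, mul_assoc]
  refine ⟨hp_one, fun s hs => ⟨?_, ?_⟩⟩
  · rw [hderiv s hs]; positivity
  · rw [hderiv₂ s hs, hderiv s hs, hh s]
    exact rpow_profile_equation hp_pos hτpos hs hexp hcoef
end

section
/- Let n ≥ 1, β ∈ [0,2], m ∈ (0, 3 − β], c₁ ≥ 0, c₂ ≥ 0, and let Ω ⊆ ℝⁿ be open. Let f : [0,∞) × ℝ → ℝ be continuous and satisfy sup { f(|x|, t) : x ∈ Ω, t ∈ I } < ∞ for every compact set I ⊂ ℝ. Suppose v : Ω → ℝ is bounded, upper semicontinuous, and is a viscosity subsolution of Δ∞^β v = −c₁ |∇v|^m − c₂ f(|x|, v) in Ω. Then v is locally Lipschitz continuous in Ω. -/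
open scoped RealInnerProductSpace

/-- The second-order test quantity `⟨D²φ(x) w, w⟩`, where the Hessian `D²φ(x)` is realized
as the derivative of the gradient of `φ`. -/
noncomputable def hessQF {n : ℕ} (φ : EuclideanSpace ℝ (Fin n) → ℝ)
    (x w : EuclideanSpace ℝ (Fin n)) : ℝ :=
  ⟪fderiv ℝ (gradient φ) x w, w⟫

/-- `u` is a viscosity subsolution of `Δ∞^β u = G(x, u, ∇u)` on the open set `Ω`. -/
def IsViscositySubsolution {n : ℕ} (β : ℝ) (Ω : Set (EuclideanSpace ℝ (Fin n)))
    (G : EuclideanSpace ℝ (Fin n) → ℝ → EuclideanSpace ℝ (Fin n) → ℝ)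
    (u : EuclideanSpace ℝ (Fin n) → ℝ) : Prop :=
  ∀ φ : EuclideanSpace ℝ (Fin n) → ℝ, ContDiff ℝ 2 φ →
    ∀ x₀ ∈ Ω, IsLocalMaxOn (fun x => u x - φ x) Ω x₀ →
      (gradient φ x₀ ≠ 0 →
        G x₀ (u x₀) (gradient φ x₀) ≤
          ‖gradient φ x₀‖ ^ (-β) * hessQF φ x₀ (gradient φ x₀)) ∧
      (gradient φ x₀ = 0 → β < 2 → G x₀ (u x₀) 0 ≤ 0) ∧
      (gradient φ x₀ = 0 → β = 2 →
        G x₀ (u x₀) 0 ≤ sSup {t : ℝ | ∃ w, ‖w‖ = 1 ∧ t = hessQF φ x₀ w})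

/-- `u` is a viscosity supersolution of `Δ∞^β u = G(x, u, ∇u)` on the open set `Ω`. -/
def IsViscositySupersolution {n : ℕ} (β : ℝ) (Ω : Set (EuclideanSpace ℝ (Fin n)))
    (G : EuclideanSpace ℝ (Fin n) → ℝ → EuclideanSpace ℝ (Fin n) → ℝ)
    (u : EuclideanSpace ℝ (Fin n) → ℝ) : Prop :=
  ∀ φ : EuclideanSpace ℝ (Fin n) → ℝ, ContDiff ℝ 2 φ →
    ∀ x₀ ∈ Ω, IsLocalMinOn (fun x => u x - φ x) Ω x₀ →
      (gradient φ x₀ ≠ 0 →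
        ‖gradient φ x₀‖ ^ (-β) * hessQF φ x₀ (gradient φ x₀) ≤
          G x₀ (u x₀) (gradient φ x₀)) ∧
      (gradient φ x₀ = 0 → β < 2 → 0 ≤ G x₀ (u x₀) 0) ∧
      (gradient φ x₀ = 0 → β = 2 →
        sInf {t : ℝ | ∃ w, ‖w‖ = 1 ∧ t = hessQF φ x₀ w} ≤ G x₀ (u x₀) 0)

/-- `u` is a viscosity solution of `Δ∞^β u = G(x, u, ∇u)` on the open set `Ω`. -/
def IsViscositySolution {n : ℕ} (β : ℝ) (Ω : Set (EuclideanSpace ℝ (Fin n)))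
    (G : EuclideanSpace ℝ (Fin n) → ℝ → EuclideanSpace ℝ (Fin n) → ℝ)
    (u : EuclideanSpace ℝ (Fin n) → ℝ) : Prop :=
  IsViscositySubsolution β Ω G u ∧ IsViscositySupersolution β Ω G u

open Real Filter

/-- The gradient of the radial function `x ↦ F (‖x - y‖ ^ 2)`. -/
theorem gradient_radial {n : ℕ} {F F' : ℝ → ℝ} (hF : ∀ s, HasDerivAt F (F' s) s)
    (y x : EuclideanSpace ℝ (Fin n)) :
    gradient (fun x => F (‖x - y‖ ^ 2)) x = (2 * F' (‖x - y‖ ^ 2)) • (x - y) := by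
  have h1 : HasFDerivAt (fun x => ‖x - y‖ ^ 2) (2 • innerSL ℝ (x - y)) x := by
    simpa using ((hasFDerivAt_id x).sub_const y).norm_sq
  refine HasGradientAt.gradient ?_
  rw [hasGradientAt_iff_hasFDerivAt]
  refine ((hF (‖x - y‖ ^ 2)).comp_hasFDerivAt x h1).congr_fderiv ?_
  ext w
  simp
  ring

/-- The Hessian quadratic form of the radial function `x ↦ F (‖x - y‖ ^ 2)`. -/
theorem hessQF_radial {n : ℕ} {F F' F'' : ℝ → ℝ} (hF : ∀ s, HasDerivAt F (F' s) s)
    (hF' : ∀ s, HasDerivAt F' (F'' s) s) (y x w : EuclideanSpace ℝ (Fin n)) :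
    hessQF (fun x => F (‖x - y‖ ^ 2)) x w =
      2 * F' (‖x - y‖ ^ 2) * ‖w‖ ^ 2 + 4 * F'' (‖x - y‖ ^ 2) * ⟪x - y, w⟫ ^ 2 := by
  have h1 : HasFDerivAt (fun x => ‖x - y‖ ^ 2) (2 • innerSL ℝ (x - y)) x := by
    simpa using ((hasFDerivAt_id x).sub_const y).norm_sq
  have h2 := (((hF' (‖x - y‖ ^ 2)).comp_hasFDerivAt x h1).const_mul 2).smul
    ((hasFDerivAt_id x).sub_const y)
  have h3 : gradient (fun x => F (‖x - y‖ ^ 2)) =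
      fun x => (2 * F' (‖x - y‖ ^ 2)) • (x - y) := funext (gradient_radial hF y)
  have h4 : HasFDerivAt (gradient (fun x => F (‖x - y‖ ^ 2))) _ x :=
    h2.congr_of_eventuallyEq (Filter.Eventually.of_forall (congrFun h3))
  rw [hessQF, h4.fderiv]
  simp [inner_add_left, inner_sub_left, real_inner_smul_left]
  ring

/-- A polynomial in `r ^ 2` touching `r` from above at `R` to third order. -/
theorem le_sextic_of_pos {r R : ℝ} (hr : 0 ≤ r) (hR : 0 < R) :
    r ≤ R / 16 * ((r ^ 2 / R ^ 2) ^ 3 - 5 * (r ^ 2 / R ^ 2) ^ 2 + 15 * (r ^ 2 / R ^ 2) + 5) := by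
  obtain ⟨z, hz, rfl⟩ : ∃ z, 0 ≤ z ∧ r = R * z := ⟨r / R, by positivity, by field_simp⟩
  have h : (R * z) ^ 2 / R ^ 2 = z ^ 2 := by field_simp
  rw [h]
  have : 0 ≤ R / 16 * ((z - 1) ^ 4 * (z ^ 2 + 4 * z + 5)) := by positivity
  linarith

/-- The slope-`q` barrier is a strict supersolution. -/
theorem barrier_strict {β m c₁ C a q l : ℝ} (hm : m ≤ 3 - β) (hβ : β ≤ 2) (hc₁ : 0 ≤ c₁)
    (hC : 0 ≤ C) (hq : 1 ≤ q) (hqa : q ≤ a) (hl : c₁ + C < l) :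
    q ^ (-β) * (q ^ 2 * (-(a * l))) < -c₁ * q ^ m - C := by
  have hq0 : 0 < q := by linarith
  have hQ : q ^ (-β) * q ^ 2 = q ^ (2 - β) := by
    rw [← Real.rpow_natCast q 2, ← Real.rpow_add hq0]; congr 1; push_cast; ring
  have hQ1 : 1 ≤ q ^ (2 - β) := Real.one_le_rpow hq (by linarith)
  have hqm : q ^ m ≤ q ^ (2 - β) * q := by
    calc q ^ m ≤ q ^ (2 - β + 1) := Real.rpow_le_rpow_of_exponent_le hq (by linarith)
      _ = _ := by rw [Real.rpow_add hq0, Real.rpow_one]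
  rw [← mul_assoc, hQ]
  set Q := q ^ (2 - β)
  have hQq : 1 ≤ Q * q := one_le_mul_of_one_le_of_one_le hQ1 hq
  have h1 : c₁ * q ^ m ≤ c₁ * (Q * q) := mul_le_mul_of_nonneg_left hqm hc₁
  have h2 : C ≤ C * (Q * q) := le_mul_of_one_le_right hC hQq
  have h3 : (c₁ + C) * (Q * q) < l * (Q * q) := mul_lt_mul_of_pos_right hl (by linarith)
  have h4 : l * (Q * q) ≤ l * (Q * a) := by gcongr; linarith
  linarith

/-- One-sided cone comparison: a subsolution grows at most linearly away from the centre of a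
small ball. -/
theorem cone_comparison {n : ℕ} {β m c₁ C M l a ρ : ℝ} {Ω : Set (EuclideanSpace ℝ (Fin n))}
    {G : EuclideanSpace ℝ (Fin n) → ℝ → EuclideanSpace ℝ (Fin n) → ℝ}
    {v : EuclideanSpace ℝ (Fin n) → ℝ} (hβ : β ≤ 2) (hm : m ≤ 3 - β) (hc₁ : 0 ≤ c₁) (hC : 0 ≤ C)
    (hG : ∀ x ∈ Ω, ∀ p, -c₁ * ‖p‖ ^ m - C ≤ G x (v x) p)
    (hM : ∀ x ∈ Ω, |v x| ≤ M) (hv : UpperSemicontinuousOn v Ω)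
    (hsub : IsViscositySubsolution β Ω G v) (hl : c₁ + C < l) (hlρ : l * ρ ≤ 1 / 2)
    (ha : 2 ≤ a) (haρ : 4 * M < a * ρ) {y : EuclideanSpace ℝ (Fin n)} (hρ : 0 < ρ)
    (hy : Metric.closedBall y ρ ⊆ Ω) :
    ∀ x ∈ Metric.closedBall y ρ, v x ≤ v y + a * ‖x - y‖ := by
  have hl0 : 0 < l := by linarith
  have hyΩ : y ∈ Ω := hy (Metric.mem_closedBall_self hρ.le)
  set w : EuclideanSpace ℝ (Fin n) → ℝ := fun x => a * (‖x - y‖ - l / 2 * ‖x - y‖ ^ 2) with hw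
  suffices h : ∀ x ∈ Metric.closedBall y ρ, v x - w x ≤ v y by
    intro x hx
    have h1 := h x hx
    have h2 : 0 ≤ a * (l / 2 * ‖x - y‖ ^ 2) := by positivity
    simp only [hw] at h1
    linarith
  obtain ⟨z, hz, hmax⟩ : ∃ z ∈ Metric.closedBall y ρ,
      IsMaxOn (fun x => v x + -w x) (Metric.closedBall y ρ) z := by
    refine UpperSemicontinuousOn.exists_isMaxOn (Metric.nonempty_closedBall.2 hρ.le)
      (isCompact_closedBall y ρ) ?_
    have hwc : Continuous fun x => -w x := by fun_prop
    exact (hv.mono hy).add (hwc.upperSemicontinuous.upperSemicontinuousOn _)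
  intro x hx
  by_contra! hlt
  have hzlt : v y < v z - w z := by
    have := hmax hx
    simp only [Set.mem_ofPred_eq] at this
    linarith
  set R := ‖z - y‖ with hRdef
  have hRρ : R ≤ ρ := by simpa [hRdef, dist_eq_norm] using hz
  have hR : 0 < R := by
    refine norm_pos_iff.2 (sub_ne_zero.2 ?_)
    rintro rfl
    simp [hw] at hzlt
  have hlR : l * R ≤ 1 / 2 := (mul_le_mul_of_nonneg_left hRρ hl0.le).trans hlρ
  have hwz : w z = a * (R - l / 2 * R ^ 2) := rfl
  have hRlt : R < ρ := by
    refine lt_of_le_of_ne hRρ fun hEq => ?_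
    have h1 := abs_le.1 (hM z (hy hz))
    have h2 := abs_le.1 (hM y hyΩ)
    have h3 : a * ρ * (l * ρ) ≤ a * ρ * (1 / 2) := by gcongr
    rw [hwz, hEq] at hzlt
    nlinarith
  set F : ℝ → ℝ := fun s =>
    a * (R / 16 * ((s / R ^ 2) ^ 3 - 5 * (s / R ^ 2) ^ 2 + 15 * (s / R ^ 2) + 5) - l / 2 * s)
    with hFdef
  set F' : ℝ → ℝ := fun s =>
    a * (R / 16 * (3 * (s / R ^ 2) ^ 2 - 10 * (s / R ^ 2) + 15) / R ^ 2 - l / 2) with hF'def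
  set F'' : ℝ → ℝ := fun s => a * (R / 16 * (6 * (s / R ^ 2) - 10) / R ^ 4) with hF''def
  have hF : ∀ s, HasDerivAt F (F' s) s := by
    intro s
    have hu : HasDerivAt (fun s : ℝ => s / R ^ 2) (1 / R ^ 2) s := (hasDerivAt_id s).div_const _
    refine HasDerivAt.congr_deriv (((((((hu.pow 3).sub ((hu.pow 2).const_mul 5)).add (hu.const_mul 15)).add_const
      5).const_mul (R / 16)).sub ((hasDerivAt_id s).const_mul (l / 2))).const_mul a) ?_
    simp only [hF'def]
    push_cast
    field_simp
    ring
  have hF' : ∀ s, HasDerivAt F' (F'' s) s := by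
    intro s
    have hu : HasDerivAt (fun s : ℝ => s / R ^ 2) (1 / R ^ 2) s := (hasDerivAt_id s).div_const _
    refine HasDerivAt.congr_deriv (((((((hu.pow 2).const_mul 3).sub (hu.const_mul 10)).add_const 15).const_mul
      (R / 16)).div_const (R ^ 2) |>.sub_const (l / 2)).const_mul a) ?_
    simp only [hF''def]
    push_cast
    field_simp
    ring
  have hwF : ∀ x, w x ≤ F (‖x - y‖ ^ 2) := by
    intro x
    have := le_sextic_of_pos (norm_nonneg (x - y)) hR
    simp only [hw, hFdef]
    gcongr
  have hFz : F (R ^ 2) = w z := by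
    simp only [hFdef, hwz]
    field_simp
    ring
  have hF'z : F' (R ^ 2) = a * (1 - l * R) / (2 * R) := by
    simp only [hF'def]
    field_simp
    ring
  have hF''z : F'' (R ^ 2) = -a / (4 * R ^ 3) := by
    simp only [hF''def]
    field_simp
    ring
  have hlocal : IsLocalMaxOn (fun x => v x - F (‖x - y‖ ^ 2)) Ω z := by
    refine IsLocalMax.on ?_ Ω
    have hnhds : Metric.closedBall y ρ ∈ nhds z :=
      Filter.mem_of_superset (Metric.isOpen_ball.mem_nhds
        (by simpa [Metric.mem_ball, dist_eq_norm] using hRlt)) Metric.ball_subset_closedBall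
    filter_upwards [hnhds] with x hx
    have h1 := hmax hx
    have h2 := hwF x
    simp only [Set.mem_ofPred_eq] at h1
    rw [← hRdef, hFz]
    linarith
  have hsmooth : ContDiff ℝ 2 (fun x : EuclideanSpace ℝ (Fin n) => F (‖x - y‖ ^ 2)) := by
    have hs : ContDiff ℝ 2 (fun x : EuclideanSpace ℝ (Fin n) => ‖x - y‖ ^ 2) :=
      (contDiff_id.sub contDiff_const).norm_sq ℝ
    simp only [hFdef]
    fun_prop
  have hgrad := gradient_radial hF y z
  rw [← hRdef, hF'z] at hgrad
  set q := a * (1 - l * R) with hq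
  have hq1 : 1 ≤ q := by nlinarith
  have hqa : q ≤ a := by
    have : 0 ≤ a * (l * R) := by positivity
    linarith
  have hnorm : ‖gradient (fun x => F (‖x - y‖ ^ 2)) z‖ = q := by
    rw [hgrad, norm_smul, ← hRdef, Real.norm_of_nonneg (by positivity)]
    field_simp
  have hne : gradient (fun x => F (‖x - y‖ ^ 2)) z ≠ 0 := by
    rw [← norm_pos_iff, hnorm]
    linarith
  have hhess : hessQF (fun x => F (‖x - y‖ ^ 2)) z
      (gradient (fun x => F (‖x - y‖ ^ 2)) z) = q ^ 2 * (-(a * l)) := by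
    rw [hessQF_radial hF hF', hnorm, hgrad, inner_smul_right, real_inner_self_eq_norm_sq,
      ← hRdef, hF'z, hF''z]
    field_simp
    rw [hq]
    ring
  have hineq := (hsub _ hsmooth z (hy hz) hlocal).1 hne
  have hlow := hG z (hy hz) (gradient (fun x => F (‖x - y‖ ^ 2)) z)
  rw [hnorm, hhess] at hineq
  rw [hnorm] at hlow
  exact absurd (hlow.trans hineq) (not_le.2 (barrier_strict hm hβ hc₁ hC hq1 hqa hl))

/-- **Local Lipschitz regularity for viscosity subsolutions** (Lemma 3.1).
A bounded, upper semicontinuous viscosity subsolution of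
`Δ∞^β v = −c₁|∇v|^m − c₂ f(|x|, v)` on an open set `Ω` is locally Lipschitz in `Ω`. -/
theorem locally_lipschitz_of_viscosity_subsolution
    (n : ℕ) (hn : 1 ≤ n) (β m c₁ c₂ : ℝ)
    (hβ : β ∈ Set.Icc (0 : ℝ) 2) (hm : m ∈ Set.Ioc (0 : ℝ) (3 - β))
    (hc₁ : 0 ≤ c₁) (hc₂ : 0 ≤ c₂)
    (Ω : Set (EuclideanSpace ℝ (Fin n))) (hΩ : IsOpen Ω)
    (f : ℝ → ℝ → ℝ) (hf : Continuous fun q : ℝ × ℝ => f q.1 q.2)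
    (hfb : ∀ I : Set ℝ, IsCompact I →
      BddAbove {y : ℝ | ∃ x ∈ Ω, ∃ t ∈ I, y = f ‖x‖ t})
    (v : EuclideanSpace ℝ (Fin n) → ℝ)
    (hvb : ∃ M : ℝ, ∀ x ∈ Ω, |v x| ≤ M)
    (hvu : UpperSemicontinuousOn v Ω)
    (hsub : IsViscositySubsolution β Ω
      (fun x t p => -c₁ * ‖p‖ ^ m - c₂ * f ‖x‖ t) v) :
    ∀ x ∈ Ω, ∃ K : NNReal, ∃ s ∈ nhdsWithin x Ω, LipschitzOnWith K v s := by
  obtain ⟨M, hM⟩ := hvb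
  obtain ⟨B, hB⟩ := hfb (Set.Icc (-M) M) isCompact_Icc
  intro x hx
  set C := c₂ * max B 0 with hCdef
  have hC : 0 ≤ C := by positivity
  obtain ⟨ε, hε, hball⟩ := Metric.isOpen_iff.1 hΩ x hx
  set l := c₁ + C + 1 with hldef
  have hl : 0 < l := by positivity
  set ρ := min (ε / 4) (1 / (2 * l)) with hρdef
  have hρ : 0 < ρ := by positivity
  have hlρ : l * ρ ≤ 1 / 2 := by
    calc l * ρ ≤ l * (1 / (2 * l)) := by gcongr; exact min_le_right _ _
      _ = 1 / 2 := by field_simp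
  set a := max 2 ((4 * M + 1) / ρ) with hadef
  have haρ : 4 * M < a * ρ := by
    have := (div_le_iff₀ hρ).1 (le_max_right 2 ((4 * M + 1) / ρ))
    linarith
  have hG : ∀ z ∈ Ω, ∀ p : EuclideanSpace ℝ (Fin n),
      -c₁ * ‖p‖ ^ m - C ≤ -c₁ * ‖p‖ ^ m - c₂ * f ‖z‖ (v z) := by
    intro z hz p
    have hfz : f ‖z‖ (v z) ≤ max B 0 :=
      (hB ⟨z, hz, v z, abs_le.1 (hM z hz), rfl⟩).trans (le_max_left _ _)
    have := mul_le_mul_of_nonneg_left hfz hc₂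
    linarith
  have key : ∀ y ∈ Metric.ball x (ρ / 2), ∀ z ∈ Metric.ball x (ρ / 2),
      v z ≤ v y + a * dist z y := by
    intro y hy z hz
    rw [Metric.mem_ball] at hy hz
    have hsubset : Metric.closedBall y ρ ⊆ Ω := by
      intro u hu
      refine hball ?_
      rw [Metric.mem_closedBall] at hu
      rw [Metric.mem_ball]
      have h1 := dist_triangle u y x
      have h2 : ρ ≤ ε / 4 := min_le_left _ _
      linarith
    rw [dist_eq_norm]
    refine cone_comparison hβ.2 hm.2 hc₁ hC hG hM hvu hsub (by linarith) hlρ (le_max_left _ _)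
      haρ hρ hsubset z ?_
    rw [Metric.mem_closedBall]
    have := dist_triangle_right z y x
    linarith
  refine ⟨a.toNNReal, Metric.ball x (ρ / 2),
    mem_nhdsWithin_of_mem_nhds (Metric.ball_mem_nhds x (by positivity)), ?_⟩
  refine LipschitzOnWith.of_le_add_mul _ fun z hz y hy => ?_
  rw [Real.coe_toNNReal a (zero_le_two.trans (le_max_left _ _))]
  exact key y hy z hz
end

section
/- Sharpness of Liouville-type result I: let n ≥ 1, β ∈ [0,2], γ ∈ [0, 3 − β), α > −1 − γ, λ > 0. Set p = (4 − β + α)/(3 − β − γ) and θ = (λ (3 − β − γ)^(4−β) / ((4 − β + α)^(3−β) (1 + α + γ)))^(1/(3−β−γ)), and define h(x) := θ |x|^p for x ∈ ℝⁿ. Then h is twice differentiable on ℝⁿ \ {0}, ∇h(x) ≠ 0 for x ≠ 0, and for every x ≠ 0 one has ⟨D²h(x) ∇h(x), ∇h(x)⟩ = |∇h(x)|^β · λ |x|^α (h(x))^γ; moreover limsup_{|x| → ∞} h(x)/|x|^p = θ. In particular, h is a classical solution of Δ∞^β h = λ |x|^α h^γ on ℝⁿ \ {0} attaining the critical growth rate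 θ with equality. -/
open scoped RealInnerProductSpace
open Real Filter

section RadialPower

variable {E : Type*} [NormedAddCommGroup E] [InnerProductSpace ℝ E]

theorem hasFDerivAt_norm_rpow_of_ne_zero {x : E} (hx : x ≠ 0) (q : ℝ) :
    HasFDerivAt (fun y : E => ‖y‖ ^ q) ((q * ‖x‖ ^ (q - 2)) • innerSL ℝ x) x := by
  have hr : 0 < ‖x‖ := norm_pos_iff.mpr hx
  have key := ((hasStrictFDerivAt_norm_sq x).hasFDerivAt).rpow_const (p := q / 2)
    (Or.inl (by positivity))
  convert key using 1
  · funext y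
    rw [← Real.rpow_natCast, ← Real.rpow_mul (norm_nonneg y)]
    congr 1
    push_cast
    ring
  · rw [← Real.rpow_natCast, ← Real.rpow_mul hr.le, ← Nat.cast_smul_eq_nsmul ℝ, smul_smul]
    congr 1
    rw [show ((2 : ℕ) : ℝ) * (q / 2 - 1) = q - 2 by push_cast; ring]
    push_cast
    ring

theorem hasGradientAt_const_mul_norm_rpow [CompleteSpace E] {x : E} (hx : x ≠ 0) (c q : ℝ) :
    HasGradientAt (fun y : E => c * ‖y‖ ^ q) ((c * q * ‖x‖ ^ (q - 2)) • x) x := by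
  rw [hasGradientAt_iff_hasFDerivAt]
  refine ((hasFDerivAt_norm_rpow_of_ne_zero hx q).const_mul c).congr_fderiv ?_
  ext v
  simp
  ring

theorem hasFDerivAt_gradient_const_mul_norm_rpow [CompleteSpace E] {x : E} (hx : x ≠ 0)
    (c q : ℝ) :
    HasFDerivAt (gradient fun y : E => c * ‖y‖ ^ q)
      ((c * q * ‖x‖ ^ (q - 2)) • ContinuousLinearMap.id ℝ E +
        ((c * q) • (((q - 2) * ‖x‖ ^ (q - 2 - 2)) • innerSL ℝ x)).smulRight x) x := by
  have hloc : gradient (fun y : E => c * ‖y‖ ^ q) =ᶠ[nhds x]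
      fun y => (c * q * ‖y‖ ^ (q - 2)) • y := by
    filter_upwards [isOpen_ne.mem_nhds hx] with y hy
    exact (hasGradientAt_const_mul_norm_rpow hy c q).gradient
  exact (((hasFDerivAt_norm_rpow_of_ne_zero hx (q - 2)).const_mul (c * q)).smul
    (hasFDerivAt_id x)).congr_of_eventuallyEq hloc

theorem norm_gradient_const_mul_norm_rpow [CompleteSpace E] {x : E} (hx : x ≠ 0) {c q : ℝ}
    (hc : 0 ≤ c) (hq : 0 ≤ q) :
    ‖gradient (fun y : E => c * ‖y‖ ^ q) x‖ = c * q * ‖x‖ ^ (q - 1) := by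
  have hr : 0 < ‖x‖ := norm_pos_iff.mpr hx
  rw [(hasGradientAt_const_mul_norm_rpow hx c q).gradient, norm_smul, Real.norm_of_nonneg
    (by positivity), mul_assoc, ← Real.rpow_add_one hr.ne']
  ring_nf

theorem inner_hessian_const_mul_norm_rpow [CompleteSpace E] {x : E} (hx : x ≠ 0) (c q : ℝ) :
    ⟪fderiv ℝ (gradient fun y : E => c * ‖y‖ ^ q) x (gradient (fun y : E => c * ‖y‖ ^ q) x),
      gradient (fun y : E => c * ‖y‖ ^ q) x⟫ =
      (c * q) ^ 3 * (q - 1) * ‖x‖ ^ (3 * q - 4) := by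
  have hr : 0 < ‖x‖ := norm_pos_iff.mpr hx
  have h₁ : ‖x‖ ^ (q - 2) = ‖x‖ ^ (q - 2 - 2) * ‖x‖ ^ 2 := by
    rw [← Real.rpow_natCast, ← Real.rpow_add hr]
    congr 1
    push_cast
    ring
  have h₂ : ‖x‖ ^ (3 * q - 4) = (‖x‖ ^ (q - 2)) ^ 3 * ‖x‖ ^ 2 := by
    rw [← Real.rpow_natCast, ← Real.rpow_natCast, ← Real.rpow_mul hr.le, ← Real.rpow_add hr]
    congr 1
    push_cast
    ring
  rw [(hasFDerivAt_gradient_const_mul_norm_rpow hx c q).fderiv,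
    (hasGradientAt_const_mul_norm_rpow hx c q).gradient, h₂, h₁]
  simp [inner_smul_left, inner_smul_right, inner_add_left]
  ring

end RadialPower

/-- The coefficient identity behind the radial solution, with `D = 3 - β - γ`,
`A = 4 - β + α` and `B = 1 + α + γ`. -/
theorem critical_coefficient_identity {β γ A B D lam : ℝ} (hA : 0 < A) (hB : 0 < B) (hD : 0 < D)
    (hlam : 0 < lam) (hsum : D = 3 - β - γ) (hAB : A = D + B) {θ : ℝ} (hθ₀ : 0 < θ)
    (hθ : θ = (lam * D ^ (4 - β) / (A ^ (3 - β) * B)) ^ (1 / D)) :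
    (θ * (A / D)) ^ 3 * (A / D - 1) = (θ * (A / D)) ^ β * (lam * θ ^ γ) := by
  have hp : 0 < A / D := by positivity
  have hpow : θ ^ D = lam * D ^ (4 - β) / (A ^ (3 - β) * B) := by
    rw [hθ, ← Real.rpow_mul (by positivity), one_div_mul_cancel hD.ne', Real.rpow_one]
  have hθ₃ : θ ^ 3 = θ ^ β * θ ^ γ * θ ^ D := by
    rw [← Real.rpow_add hθ₀, ← Real.rpow_add hθ₀, hsum, ← Real.rpow_natCast]
    congr 1
    push_cast
    ring
  have hp₃ : (A / D) ^ 3 = (A / D) ^ β * (A ^ (3 - β) / D ^ (3 - β)) := by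
    rw [← Real.div_rpow hA.le hD.le, ← Real.rpow_add hp, ← Real.rpow_natCast]
    congr 1
    push_cast
    ring
  have hD₄ : D ^ (4 - β) = D ^ (3 - β) * D := by
    rw [← Real.rpow_add_one hD.ne']
    ring_nf
  have hAD : A / D - 1 = B / D := by
    rw [hAB]
    field_simp
    ring
  have hA' : 0 < A ^ (3 - β) := by positivity
  have hD' : 0 < D ^ (3 - β) := by positivity
  rw [mul_pow, Real.mul_rpow hθ₀.le hp.le, hp₃, hθ₃, hpow, hD₄, hAD]
  generalize (A / D) ^ β = u
  field_simp

/-- **Sharpness of Liouville-type result I** (Corollary 5.2).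
With `p = (4−β+α)/(3−β−γ)` and `θ = (λ(3−β−γ)^(4−β)/((4−β+α)^(3−β)(1+α+γ)))^(1/(3−β−γ))`,
the function `h(x) = θ |x|^p` is a classical solution of `Δ∞^β h = λ |x|^α h^γ` away from
the origin, i.e. `⟨D²h ∇h, ∇h⟩ = |∇h|^β · λ|x|^α h^γ` with `∇h ≠ 0` there, and it attains
the critical growth rate: `limsup_{|x|→∞} h(x)/|x|^p = θ`. -/
theorem sharpness_liouville_type_result_I
    (n : ℕ) (hn : 1 ≤ n) (β γ α lam : ℝ)
    (hβ : β ∈ Set.Icc (0 : ℝ) 2) (hγ : γ ∈ Set.Ico (0 : ℝ) (3 - β))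
    (hα : -1 - γ < α) (hlam : 0 < lam)
    (p θ : ℝ)
    (hp : p = (4 - β + α) / (3 - β - γ))
    (hθ : θ = (lam * (3 - β - γ) ^ (4 - β) /
        ((4 - β + α) ^ (3 - β) * (1 + α + γ))) ^ (1 / (3 - β - γ)))
    (h : EuclideanSpace ℝ (Fin n) → ℝ)
    (hh : ∀ x, h x = θ * ‖x‖ ^ p) :
    (∀ x : EuclideanSpace ℝ (Fin n), x ≠ 0 →
      DifferentiableAt ℝ h x ∧ DifferentiableAt ℝ (gradient h) x ∧
      gradient h x ≠ 0 ∧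
      ⟪fderiv ℝ (gradient h) x (gradient h x), gradient h x⟫ =
        ‖gradient h x‖ ^ β * (lam * ‖x‖ ^ α * (h x) ^ γ)) ∧
    Filter.limsup (fun x => h x / ‖x‖ ^ p)
      (Bornology.cobounded (EuclideanSpace ℝ (Fin n))) = θ := by
  obtain rfl : h = fun x => θ * ‖x‖ ^ p := funext hh
  have hD : 0 < 3 - β - γ := by linarith [hγ.2]
  have hB : 0 < 1 + α + γ := by linarith
  have hA : 0 < 4 - β + α := by linarith
  have hp₀ : 0 < p := hp ▸ div_pos hA hD
  have hθ₀ : 0 < θ := by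
    rw [hθ]
    positivity
  have hcoef := critical_coefficient_identity hA hB hD hlam rfl (by ring) hθ₀ hθ
  rw [← hp] at hcoef
  have hexp : p * (3 - β - γ) = 4 - β + α := by
    rw [hp]
    field_simp
  refine ⟨fun x hx => ?_, ?_⟩
  · have hr : 0 < ‖x‖ := norm_pos_iff.mpr hx
    have hnorm := norm_gradient_const_mul_norm_rpow hx hθ₀.le hp₀.le
    refine ⟨(hasGradientAt_const_mul_norm_rpow hx θ p).differentiableAt,
      (hasFDerivAt_gradient_const_mul_norm_rpow hx θ p).differentiableAt, ?_, ?_⟩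
    · rw [← norm_pos_iff, hnorm]
      positivity
    · have hpow : ‖x‖ ^ (3 * p - 4) =
          (‖x‖ ^ (p - 1)) ^ β * (‖x‖ ^ α * (‖x‖ ^ p) ^ γ) := by
        rw [← Real.rpow_mul hr.le, ← Real.rpow_mul hr.le, ← Real.rpow_add hr,
          ← Real.rpow_add hr]
        congr 1
        linarith
      rw [inner_hessian_const_mul_norm_rpow hx, hnorm, hcoef, hpow,
        Real.mul_rpow (x := θ * p) (by positivity) (by positivity),
        Real.mul_rpow hθ₀.le (Real.rpow_nonneg hr.le p)]
      ring
  · have : NeZero n := ⟨by omega⟩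
    have hev : (fun x : EuclideanSpace ℝ (Fin n) => θ * ‖x‖ ^ p / ‖x‖ ^ p)
        =ᶠ[Bornology.cobounded (EuclideanSpace ℝ (Fin n))] fun _ => θ := by
      filter_upwards [tendsto_norm_cobounded_atTop.eventually_gt_atTop 0] with x hx
      exact mul_div_cancel_right₀ _ (Real.rpow_pos_of_pos hx p).ne'
    rw [limsup_congr hev, limsup_const]
end

section
/- Liouville-type result IV (exponential nonlinearity): let n ≥ 1, β ∈ [0,2], m ∈ (0, 2 − β], λ ≥ 0, γ ≥ 0, α ∈ (−1, 0], and let a : ℝⁿ → ℝ be continuous with inf_{x ∈ ℝⁿ} a(x) > 0. Let u : ℝⁿ → ℝ be a continuous viscosity solution of Δ∞^β u = a(x)(|x| + 1)^α |∇u|^m + λ |u|^γ e^u in ℝⁿ. If lim_{R → ∞} (osc_{B_R} u)/R = 0, where osc_{B_R} u = sup_{B_R} u − inf_{B_R} u and B_R is the open ball of radius R centered at the origin, then u is constant. -/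
open scoped RealInnerProductSpace

open Real Filter Metric

/-- A smooth approximation, strictly concave in the radial direction away from the vertex `x`,
of the cone `z ↦ A * ‖z - x‖`. -/
noncomputable def smoothCone {n : ℕ} (A δ η : ℝ) (x z : EuclideanSpace ℝ (Fin n)) : ℝ :=
  A * √(‖z - x‖ ^ 2 + η) - δ * ‖z - x‖ ^ 2

section SmoothCone

variable {n : ℕ} {A δ η : ℝ}

lemma contDiff_smoothCone (hη : 0 < η) (x : EuclideanSpace ℝ (Fin n)) :
    ContDiff ℝ 2 (smoothCone A δ η x) := by
  have hs : ContDiff ℝ 2 fun z : EuclideanSpace ℝ (Fin n) => ‖z - x‖ ^ 2 :=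
    (contDiff_id.sub contDiff_const).norm_sq ℝ
  exact (contDiff_const.mul ((hs.add contDiff_const).sqrt fun z => by positivity)).sub
    (contDiff_const.mul hs)

lemma hasFDerivAt_norm_sub_sq (x z : EuclideanSpace ℝ (Fin n)) :
    HasFDerivAt (fun z => ‖z - x‖ ^ 2) ((2 : ℝ) • innerSL ℝ (z - x)) z := by
  refine ((hasFDerivAt_id z).sub_const x).norm_sq.congr_fderiv ?_
  ext w
  simp

lemma hasFDerivAt_sqrt_norm_sub_sq_add (hη : 0 < η) (x z : EuclideanSpace ℝ (Fin n)) :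
    HasFDerivAt (fun z => √(‖z - x‖ ^ 2 + η))
      ((√(‖z - x‖ ^ 2 + η))⁻¹ • innerSL ℝ (z - x)) z := by
  refine (((hasFDerivAt_norm_sub_sq x z).add_const η).sqrt (by positivity)).congr_fderiv ?_
  rw [smul_smul]
  congr 1
  field_simp

lemma gradient_smoothCone (hη : 0 < η) (x z : EuclideanSpace ℝ (Fin n)) :
    gradient (smoothCone A δ η x) z = (A * (√(‖z - x‖ ^ 2 + η))⁻¹ - 2 * δ) • (z - x) := by
  refine HasGradientAt.gradient ?_
  rw [hasGradientAt_iff_hasFDerivAt]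
  refine (((hasFDerivAt_sqrt_norm_sub_sq_add hη x z).const_mul A).sub
    ((hasFDerivAt_norm_sub_sq x z).const_mul δ)).congr_fderiv ?_
  ext w
  simp
  ring

lemma hessQF_smoothCone (hη : 0 < η) (x z w : EuclideanSpace ℝ (Fin n)) :
    hessQF (smoothCone A δ η x) z w =
      (A * (√(‖z - x‖ ^ 2 + η))⁻¹ - 2 * δ) * ‖w‖ ^ 2 -
        A * (√(‖z - x‖ ^ 2 + η))⁻¹ ^ 3 * ⟪z - x, w⟫ ^ 2 := by
  have hq : √(‖z - x‖ ^ 2 + η) ≠ 0 := (sqrt_pos.2 (by positivity)).ne'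
  have hinv := (hasDerivAt_inv hq).comp_hasFDerivAt z (hasFDerivAt_sqrt_norm_sub_sq_add hη x z)
  have h := ((hinv.const_mul A).sub_const (2 * δ)).smul ((hasFDerivAt_id z).sub_const x)
  have hgrad : gradient (smoothCone A δ η x) =
      fun z => (A * (√(‖z - x‖ ^ 2 + η))⁻¹ - 2 * δ) • (z - x) :=
    funext (gradient_smoothCone hη x)
  rw [hessQF, hgrad]
  refine (congrArg (fun L => ⟪L w, w⟫) h.fderiv).trans ?_
  simp [inner_add_left, inner_smul_left, inner_sub_left]
  field_simp
  ring

lemma hessQF_smoothCone_gradient_neg (hη : 0 < η) {x z : EuclideanSpace ℝ (Fin n)}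
    (hgrad : gradient (smoothCone A δ η x) z ≠ 0)
    (hδ : A * η < 2 * δ * ‖z - x‖ ^ 3) (hA : 0 < A) :
    hessQF (smoothCone A δ η x) z (gradient (smoothCone A δ η x) z) < 0 := by
  rw [hessQF_smoothCone hη]
  rw [gradient_smoothCone hη] at hgrad ⊢
  set q := √(‖z - x‖ ^ 2 + η) with hqdef
  set c := A * q⁻¹ - 2 * δ with hc
  obtain ⟨hc0, hv0⟩ := smul_ne_zero_iff.1 hgrad
  have hr : 0 < ‖z - x‖ := norm_pos_iff.2 hv0
  have hq : 0 < q := sqrt_pos.2 (by positivity)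
  have hq2 : q ^ 2 = ‖z - x‖ ^ 2 + η := sq_sqrt (by positivity)
  have hrq : ‖z - x‖ ^ 3 ≤ q ^ 3 :=
    pow_le_pow_left₀ hr.le (le_sqrt_of_sq_le (by linarith)) 3
  have hδ0 : 0 < δ := by
    by_contra! h
    have : 0 < A * η := by positivity
    nlinarith [pow_pos hr 3, mul_nonneg (neg_nonneg.2 h) (pow_pos hr 3).le]
  rw [norm_smul, inner_smul_right, real_inner_self_eq_norm_sq, mul_pow, norm_eq_abs, sq_abs]
  have hfac : c * (c ^ 2 * ‖z - x‖ ^ 2) - A * q⁻¹ ^ 3 * (c * ‖z - x‖ ^ 2) ^ 2 =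
      c ^ 2 * ‖z - x‖ ^ 2 * (A * η * q⁻¹ ^ 3 - 2 * δ) := by
    have : A * η * q⁻¹ ^ 3 - 2 * δ = c - A * q⁻¹ ^ 3 * ‖z - x‖ ^ 2 := by
      rw [hc, show η = q ^ 2 - ‖z - x‖ ^ 2 by linarith]
      field_simp
      ring
    rw [this]
    ring
  rw [hfac]
  refine mul_neg_of_pos_of_neg (by positivity) (sub_neg.2 ?_)
  rw [inv_pow, mul_inv_lt_iff₀ (by positivity)]
  exact hδ.trans_le (by gcongr)

end SmoothCone

/-- A subsolution with nonnegative right-hand side satisfies a comparison with cones from above: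
if it stays strictly below the cone of slope `A` and vertex `(x, u x)`, by the factor `2`,
on a sphere centred at `x`, then it stays below twice that cone inside. -/
lemma IsViscositySubsolution.sub_le_of_lt_on_sphere {n : ℕ} {β : ℝ}
    {G : EuclideanSpace ℝ (Fin n) → ℝ → EuclideanSpace ℝ (Fin n) → ℝ}
    {u : EuclideanSpace ℝ (Fin n) → ℝ} (hu : IsViscositySubsolution β Set.univ G u)
    (hG : ∀ x t v, 0 ≤ G x t v) (huc : Continuous u) {A R : ℝ} (hA : 0 < A)
    {x y : EuclideanSpace ℝ (Fin n)} (hyR : ‖y - x‖ < R)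
    (hsphere : ∀ z, ‖z - x‖ = R → u z - u x < A / 2 * R) :
    u y - u x ≤ 2 * A * ‖y - x‖ := by
  by_contra! hlt
  have hd : 0 < ‖y - x‖ := by
    refine norm_pos_iff.2 (sub_ne_zero.2 ?_)
    rintro rfl
    simp at hlt
  set d := ‖y - x‖ with hd_def
  have hR : 0 < R := hd.trans hyR
  have hAd : 0 < A * d := by positivity
  obtain ⟨r, hr, hru⟩ := Metric.continuous_iff.1 huc x (A * d / 4) (by positivity)
  set ρ := min (r / 2) d with hρ_def
  have hρ : 0 < ρ := lt_min (by positivity) hd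
  set δ := A / (8 * R) with hδ_def
  have hδ : 0 < δ := by positivity
  have hδR : δ * R = A / 8 := by rw [hδ_def]; field_simp
  set η := min ((d / 2) ^ 2) (δ * ρ ^ 3 / A) with hη_def
  have hη : 0 < η := lt_min (by positivity) (by positivity)
  have hηd : √η ≤ d / 2 := sqrt_le_iff.2 ⟨by positivity, min_le_left _ _⟩
  have hηρ : A * η ≤ δ * ρ ^ 3 := by
    have : η ≤ δ * ρ ^ 3 / A := min_le_right _ _
    rw [le_div_iff₀ hA] at this
    linarith
  set φ := smoothCone A δ η x with hφ
  obtain ⟨z, hzR, hzmax⟩ := (isCompact_closedBall x R).exists_isMaxOn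
    (nonempty_closedBall.2 hR.le)
    (huc.sub (contDiff_smoothCone (A := A) (δ := δ) hη x).continuous).continuousOn
  have hyz : u y - φ y ≤ u z - φ z :=
    hzmax (mem_closedBall.2 (by rw [dist_eq_norm]; exact hyR.le))
  have hy : A * d / 2 ≤ u y - φ y - u x := by
    have h1 : √(d ^ 2 + η) ≤ d + √η := by
      refine sqrt_le_iff.2 ⟨by positivity, ?_⟩
      nlinarith [sq_sqrt hη.le, sqrt_nonneg η]
    have h2 : φ y = A * √(d ^ 2 + η) - δ * d ^ 2 := rfl
    have h3 : A * √(d ^ 2 + η) ≤ A * (d + d / 2) := by gcongr; linarith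
    have h4 : 0 ≤ δ * d ^ 2 := by positivity
    linarith
  have hz : φ z = A * √(‖z - x‖ ^ 2 + η) - δ * ‖z - x‖ ^ 2 := rfl
  have hsqrt : ‖z - x‖ ≤ √(‖z - x‖ ^ 2 + η) := le_sqrt_of_sq_le (by linarith)
  have hzle : ‖z - x‖ ≤ R := by rwa [← dist_eq_norm, ← mem_closedBall]
  have hzlt : ‖z - x‖ < R := by
    refine lt_of_le_of_ne hzle fun h => ?_
    have h1 := hsphere z h
    rw [h] at hz hsqrt
    have h2 : A * R ≤ A * √(R ^ 2 + η) := by gcongr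
    have h3 : δ * R ^ 2 = A / 8 * R := by rw [← hδR]; ring
    nlinarith [mul_pos hA hR]
  have hρz : ρ < ‖z - x‖ := by
    by_contra! h
    have h1 : u z - u x < A * d / 4 := by
      have h2 : dist z x < r := by
        rw [dist_eq_norm]
        have := min_le_left (r / 2) d
        linarith
      exact (le_abs_self _).trans_lt (hru z h2)
    have h3 : ‖z - x‖ ≤ d := h.trans (min_le_right _ _)
    have h4 : δ * ‖z - x‖ ^ 2 ≤ δ * (R * d) := by
      rw [sq]; gcongr
    have h5 : δ * (R * d) = A * d / 8 := by rw [← mul_assoc, hδR]; ring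
    have h6 : 0 ≤ A * √(‖z - x‖ ^ 2 + η) := by positivity
    linarith
  have hgrad : gradient φ z ≠ 0 := by
    rw [hφ, gradient_smoothCone hη]
    refine smul_ne_zero (ne_of_gt ?_) (norm_pos_iff.1 (hρ.trans hρz))
    have h1 : √(‖z - x‖ ^ 2 + η) < 2 * R := by
      refine (sqrt_lt' (by positivity)).2 ?_
      have : η ≤ (d / 2) ^ 2 := min_le_left _ _
      nlinarith [norm_nonneg (z - x)]
    have h2 : 0 < √(‖z - x‖ ^ 2 + η) := sqrt_pos.2 (by positivity)
    rw [← div_eq_mul_inv, sub_pos, lt_div_iff₀ h2]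
    nlinarith
  have hmax : IsLocalMaxOn (fun w => u w - φ w) Set.univ z :=
    (hzmax.isLocalMax (closedBall_mem_nhds_of_mem
      (by rwa [mem_ball, dist_eq_norm]))).on _
  have hhess := hessQF_smoothCone_gradient_neg hη hgrad (by
    have : ρ ^ 3 ≤ ‖z - x‖ ^ 3 := by gcongr
    have h' : 0 < ‖z - x‖ ^ 3 := pow_pos (hρ.trans hρz) 3
    nlinarith [mul_pos hδ h']) hA
  have hle := (hu φ (contDiff_smoothCone hη x) z trivial hmax).1 hgrad
  have hneg : ‖gradient φ z‖ ^ (-β) * hessQF φ z (gradient φ z) < 0 :=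
    mul_neg_of_pos_of_neg (rpow_pos_of_pos (norm_pos_iff.2 hgrad) _) hhess
  exact absurd (hle.trans_lt hneg) (hG _ _ _).not_gt

/-- If the oscillation of a continuous function on centred balls grows sublinearly, then on
large spheres around any point the increments are small relative to the radius. -/
lemma eventually_sub_lt_of_tendsto_osc_div {n : ℕ} {u : EuclideanSpace ℝ (Fin n) → ℝ}
    (huc : Continuous u)
    (hosc : Tendsto (fun R : ℝ =>
        (sSup (u '' ball (0 : EuclideanSpace ℝ (Fin n)) R) -
          sInf (u '' ball (0 : EuclideanSpace ℝ (Fin n)) R)) / R)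
      atTop (nhds 0)) (x : EuclideanSpace ℝ (Fin n)) {ε : ℝ} (hε : 0 < ε) :
    ∀ᶠ R in atTop, ∀ z, ‖z - x‖ = R → u z - u x < ε * R := by
  have hev := hosc.eventually_lt_const (half_pos hε)
  have htend : Tendsto (fun R : ℝ => R + (‖x‖ + 1)) atTop atTop :=
    tendsto_atTop_add_const_right _ _ tendsto_id
  filter_upwards [htend.eventually hev, eventually_ge_atTop (‖x‖ + 1)] with R hR hRx z hz
  have hx0 := norm_nonneg x
  have hpos : 0 < R + (‖x‖ + 1) := by linarith
  rw [div_lt_iff₀ hpos] at hR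
  have hbdd : Bornology.IsBounded (u '' ball 0 (R + (‖x‖ + 1))) :=
    ((isCompact_closedBall _ _).image huc).isBounded.subset
      (Set.image_mono ball_subset_closedBall)
  have hzle : ‖z‖ ≤ R + ‖x‖ := by
    calc ‖z‖ = ‖(z - x) + x‖ := by rw [sub_add_cancel]
      _ ≤ R + ‖x‖ := hz ▸ norm_add_le _ _
  have h1 := le_csSup hbdd.bddAbove
    (Set.mem_image_of_mem u (mem_ball_zero_iff.2 (by linarith : ‖z‖ < R + (‖x‖ + 1))))
  have h2 := csInf_le hbdd.bddBelow
    (Set.mem_image_of_mem u (mem_ball_zero_iff.2 (by linarith : ‖x‖ < R + (‖x‖ + 1))))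
  nlinarith

/-- A continuous subsolution on the whole space with nonnegative right-hand side and sublinear
oscillation is constant. -/
lemma IsViscositySubsolution.eq_of_tendsto_osc_div {n : ℕ} {β : ℝ}
    {G : EuclideanSpace ℝ (Fin n) → ℝ → EuclideanSpace ℝ (Fin n) → ℝ}
    {u : EuclideanSpace ℝ (Fin n) → ℝ} (hu : IsViscositySubsolution β Set.univ G u)
    (hG : ∀ x t v, 0 ≤ G x t v) (huc : Continuous u)
    (hosc : Tendsto (fun R : ℝ =>
        (sSup (u '' ball (0 : EuclideanSpace ℝ (Fin n)) R) -
          sInf (u '' ball (0 : EuclideanSpace ℝ (Fin n)) R)) / R)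
      atTop (nhds 0)) (x y : EuclideanSpace ℝ (Fin n)) : u x = u y := by
  have key : ∀ x y, u y ≤ u x := by
    intro x y
    refine le_of_forall_pos_le_add fun ε hε => ?_
    set A := ε / (2 * (‖y - x‖ + 1)) with hA_def
    have hA : 0 < A := by positivity
    obtain ⟨R, hR, hyR⟩ := ((eventually_sub_lt_of_tendsto_osc_div huc hosc x (half_pos hA)).and
      (eventually_gt_atTop ‖y - x‖)).exists
    have h := hu.sub_le_of_lt_on_sphere hG huc hA hyR hR
    have hAε : 2 * A * (‖y - x‖ + 1) = ε := by rw [hA_def]; field_simp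
    linarith
  exact le_antisymm (key y x) (key x y)

/-- **Liouville-type result IV, exponential nonlinearity** (Theorem 5.9).
A continuous viscosity solution of `Δ∞^β u = a(x)(|x|+1)^α |∇u|^m + λ|u|^γ e^u` in `ℝⁿ`,
with `inf a > 0`, whose oscillation on balls grows sublinearly, i.e.
`(osc_{B_R} u)/R → 0` as `R → ∞`, is necessarily constant. -/
theorem liouville_type_result_IV_exponential
    (n : ℕ) (hn : 1 ≤ n) (β m lam γ α : ℝ)
    (hβ : β ∈ Set.Icc (0 : ℝ) 2) (hm : m ∈ Set.Ioc (0 : ℝ) (2 - β))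
    (hlam : 0 ≤ lam) (hγ : 0 ≤ γ) (hα : α ∈ Set.Ioc (-1 : ℝ) 0)
    (a : EuclideanSpace ℝ (Fin n) → ℝ) (hac : Continuous a)
    (hainf : ∃ ε : ℝ, 0 < ε ∧ ∀ x, ε ≤ a x)
    (u : EuclideanSpace ℝ (Fin n) → ℝ) (huc : Continuous u)
    (husol : IsViscositySolution β (Set.univ : Set (EuclideanSpace ℝ (Fin n)))
      (fun x t v => a x * (‖x‖ + 1) ^ α * ‖v‖ ^ m + lam * |t| ^ γ * Real.exp t) u)
    (hosc : Tendsto (fun R : ℝ =>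
        (sSup (u '' ball (0 : EuclideanSpace ℝ (Fin n)) R) -
          sInf (u '' ball (0 : EuclideanSpace ℝ (Fin n)) R)) / R)
      atTop (nhds 0)) :
    ∃ C : ℝ, ∀ x, u x = C := by
  obtain ⟨ε, hε, ha⟩ := hainf
  refine ⟨u 0, fun x => husol.1.eq_of_tendsto_osc_div (fun x t v => ?_) huc hosc x 0⟩
  have hax : 0 ≤ a x := hε.le.trans (ha x)
  positivity
end

section
/- Optimality of the supersolution assumption in Liouville-type result IV: let n ≥ 1, β ∈ [0,2), m ∈ (0, 2 − β], α ∈ (−1, 0], λ ≥ 0, γ ≥ 0, and set a := 2^(3−β−m−α). Then the function u(x) = 1 − e^(−|x|²) satisfies, for every x ∈ ℝⁿ, the pointwise inequality 2^(3−β) |x|^(2−β) e^((β−3)|x|²) (1 − 2|x|²) ≤ a (|x| + 1)^α (2 |x| e^(−|x|²))^m + λ (1 − e^(−|x|²))^γ e^(1 − e^(−|x|²)); that is, Δ∞^β u ≤ a (|x|+1)^α |∇u|^m + λ |u|^γ e^u holds pointwise on ℝⁿ, so u is a nonconstant classical supersolution of the equation in Liouville-type result IV, even though lim_{R→∞} (osc_{B_R}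 u)/R = 0. -/
open Real Filter Metric

/-- The radial form of the supersolution inequality, without the zeroth-order term. -/
theorem radial_gaussian_supersolution {β m α r : ℝ} (hm : 0 < m) (hmβ : m ≤ 2 - β)
    (hα : α ≤ 0) (hr : 0 ≤ r) :
    (2 : ℝ) ^ (3 - β) * r ^ (2 - β) * Real.exp ((β - 3) * r ^ 2) * (1 - 2 * r ^ 2) ≤
      (2 : ℝ) ^ (3 - β - m - α) * (r + 1) ^ α * (2 * r * Real.exp (-r ^ 2)) ^ m := by
  rcases le_total (1 - 2 * r ^ 2) 0 with h | h
  · exact (mul_nonpos_of_nonneg_of_nonpos (by positivity) h).trans (by positivity)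
  have hr1 : r ≤ 1 := by nlinarith
  have hpow : r ^ (2 - β) ≤ r ^ m := by
    rcases hr.eq_or_lt with rfl | hr0
    · rw [Real.zero_rpow hm.ne', Real.zero_rpow (by linarith)]
    · exact Real.rpow_le_rpow_of_exponent_ge hr0 hr1 hmβ
  have hexp : Real.exp ((β - 3) * r ^ 2) ≤ Real.exp (-r ^ 2) ^ m := by
    rw [← Real.exp_mul, Real.exp_le_exp]
    nlinarith [sq_nonneg r]
  have hweight : (2 : ℝ) ^ α ≤ (r + 1) ^ α :=
    Real.rpow_le_rpow_of_nonpos (by linarith) (by linarith) hα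
  calc (2 : ℝ) ^ (3 - β) * r ^ (2 - β) * Real.exp ((β - 3) * r ^ 2) * (1 - 2 * r ^ 2)
      ≤ (2 : ℝ) ^ (3 - β) * r ^ (2 - β) * Real.exp ((β - 3) * r ^ 2) :=
        mul_le_of_le_one_right (by positivity) (by nlinarith [sq_nonneg r])
    _ ≤ (2 : ℝ) ^ (3 - β) * r ^ m * Real.exp (-r ^ 2) ^ m := by gcongr
    _ = (2 : ℝ) ^ (3 - β - m - α) * 2 ^ α * (2 * r * Real.exp (-r ^ 2)) ^ m := by
        rw [Real.mul_rpow (by positivity) (by positivity), Real.mul_rpow (by positivity) hr,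
          show 3 - β = (3 - β - m - α) + α + m by ring, Real.rpow_add two_pos,
          Real.rpow_add two_pos]
        ring_nf
    _ ≤ (2 : ℝ) ^ (3 - β - m - α) * (r + 1) ^ α * (2 * r * Real.exp (-r ^ 2)) ^ m := by
        gcongr

/-- A function with values in `[0, 1]` has sublinear oscillation on balls. -/
theorem tendsto_osc_ball_div_atTop_of_mem_Icc {X : Type*} [PseudoMetricSpace X] {u : X → ℝ}
    (hu : ∀ x, u x ∈ Set.Icc (0 : ℝ) 1) (x₀ : X) :
    Tendsto (fun R : ℝ => (sSup (u '' ball x₀ R) - sInf (u '' ball x₀ R)) / R)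
      atTop (nhds 0) := by
  have hmem : ∀ R, ∀ y ∈ u '' ball x₀ R, y ∈ Set.Icc (0 : ℝ) 1 := by
    rintro R _ ⟨x, -, rfl⟩
    exact hu x
  refine squeeze_zero' ?_ ?_ tendsto_inv_atTop_zero
  · filter_upwards [eventually_gt_atTop 0] with R hR
    refine div_nonneg (sub_nonneg.2 ?_) hR.le
    exact Real.sInf_le_sSup _ ⟨0, fun y hy => (hmem R y hy).1⟩ ⟨1, fun y hy => (hmem R y hy).2⟩
  · filter_upwards [eventually_gt_atTop 0] with R hR
    rw [← one_div]
    gcongr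
    have hsup := Real.sSup_le (fun y hy => (hmem R y hy).2) zero_le_one
    have hinf := Real.sInf_nonneg (fun y hy => (hmem R y hy).1)
    linarith

/-- **Optimality of the supersolution assumption in Liouville-type result IV**
(Corollary 5.10). With `a = 2^(3−β−m−α)`, the nonconstant function
`u(x) = 1 − e^(−|x|²)` satisfies the pointwise supersolution inequality
`2^(3−β)|x|^(2−β) e^((β−3)|x|²)(1 − 2|x|²) ≤ a(|x|+1)^α (2|x| e^(−|x|²))^m
  + λ(1 − e^(−|x|²))^γ e^(1 − e^(−|x|²))`
on all of `ℝⁿ`, even though `(osc_{B_R} u)/R → 0` as `R → ∞`. -/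
theorem optimality_supersolution_liouville_IV
    (n : ℕ) (hn : 1 ≤ n) (β m α lam γ a : ℝ)
    (hβ : β ∈ Set.Ico (0 : ℝ) 2) (hm : m ∈ Set.Ioc (0 : ℝ) (2 - β))
    (hα : α ∈ Set.Ioc (-1 : ℝ) 0) (hlam : 0 ≤ lam) (hγ : 0 ≤ γ)
    (ha : a = (2 : ℝ) ^ (3 - β - m - α))
    (u : EuclideanSpace ℝ (Fin n) → ℝ)
    (hu : ∀ x, u x = 1 - Real.exp (-‖x‖ ^ 2)) :
    (∀ x : EuclideanSpace ℝ (Fin n),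
      (2 : ℝ) ^ (3 - β) * ‖x‖ ^ (2 - β) * Real.exp ((β - 3) * ‖x‖ ^ 2) *
          (1 - 2 * ‖x‖ ^ 2) ≤
        a * (‖x‖ + 1) ^ α * (2 * ‖x‖ * Real.exp (-‖x‖ ^ 2)) ^ m +
          lam * (1 - Real.exp (-‖x‖ ^ 2)) ^ γ * Real.exp (1 - Real.exp (-‖x‖ ^ 2))) ∧
    (¬ ∃ C : ℝ, ∀ x, u x = C) ∧
    Tendsto (fun R : ℝ =>
        (sSup (u '' ball (0 : EuclideanSpace ℝ (Fin n)) R) -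
          sInf (u '' ball (0 : EuclideanSpace ℝ (Fin n)) R)) / R)
      atTop (nhds 0) := by
  have hexp_le (x : EuclideanSpace ℝ (Fin n)) : Real.exp (-‖x‖ ^ 2) ≤ 1 :=
    Real.exp_le_one_iff.2 (neg_nonpos.2 (sq_nonneg _))
  refine ⟨fun x => ?_, ?_, ?_⟩
  · have hbase : 0 ≤ 1 - Real.exp (-‖x‖ ^ 2) := sub_nonneg.2 (hexp_le x)
    rw [ha]
    exact (radial_gaussian_supersolution hm.1 hm.2 hα.2 (norm_nonneg x)).trans
      (le_add_of_nonneg_right (by positivity))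
  · rintro ⟨C, hC⟩
    have h := (hC 0).trans (hC (EuclideanSpace.single ⟨0, hn⟩ 1)).symm
    simp [hu] at h
    linarith [Real.exp_lt_one_iff.2 (show (-1 : ℝ) < 0 by norm_num)]
  · refine tendsto_osc_ball_div_atTop_of_mem_Icc (fun x => ?_) 0
    rw [hu]
    exact ⟨sub_nonneg.2 (hexp_le x), sub_le_self _ (Real.exp_pos _).le⟩
end
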